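/- arXiv:1510.02812 — 2 statements merged into one kernel-verified Lean document; each statement's English description precedes it below -/
import Mathlib

section
/- Let N ≥ 1, α > N/2 and ρ > σ > 0, and let δ ∈ (0,1) satisfy N/(2α) < δ < (N+1)/(2α). Then there exist constants C1 > 0, depending only on N and α, and C2 > 0, depending only on N, α and δ, such that ∫_{B_ρ} ∫_{B_ρ ∖ B_σ} (1 + |x−y|²)^{−α} dx dy ≤ C1·(ρ^N − σ^N) and ∫_{B_ρ} ∫_{ℝ^N ∖ B_ρ} (1 + |x−y|²)^{−α} dx dy ≤ C2·ρ^{2N − 2δα}. -/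
open MeasureTheory Filter Topology Set
open scoped ENNReal NNReal

noncomputable section

/-- The non-local Gagliardo-type + potential energy `E_K(u, Ω)`. -/
def nlEnergy {E : Type*} [MeasurableSpace E] [Sub E] (μ : Measure E)
    (K : E → ℝ) (W : ℝ → ℝ) (u : E → ℝ) (Ω : Set E) : ℝ≥0∞ :=
  (1 / 4) * ∫⁻ p in ((Ωᶜ ×ˢ Ωᶜ)ᶜ : Set (E × E)),
      ENNReal.ofReal ((u p.1 - u p.2) ^ 2 * K (p.1 - p.2)) ∂(μ.prod μ)
    + ∫⁻ x in Ω, ENNReal.ofReal (W (u x)) ∂μ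

/-- `u` is a local minimizer of `E_K` in `Ω`. -/
def IsLocalMinimizer {E : Type*} [MeasurableSpace E] [Sub E] (μ : Measure E)
    (K : E → ℝ) (W : ℝ → ℝ) (u : E → ℝ) (Ω : Set E) : Prop :=
  nlEnergy μ K W u Ω ≠ ⊤ ∧
    ∀ v : E → ℝ, Measurable v → (∀ᵐ x ∂μ, x ∉ Ω → v x = u x) →
      nlEnergy μ K W u Ω ≤ nlEnergy μ K W v Ω

/-- `u` is a class A minimizer of `E_K`: a local minimizer in every bounded domain. -/
def IsClassAMinimizer {E : Type*} [NormedAddCommGroup E] [MeasurableSpace E] (μ : Measure E)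
    (K : E → ℝ) (W : ℝ → ℝ) (u : E → ℝ) : Prop :=
  ∀ Ω : Set E, IsOpen Ω → IsConnected Ω → Bornology.IsBounded Ω →
    IsLocalMinimizer μ K W u Ω

/-- The integro-differential operator `L_K`, in its non-singular form
`L_K u (x) = (1/2) ∫ (u(x+z) + u(x-z) - 2 u(x)) K(z) dz`. -/
def opLK {E : Type*} [NormedAddCommGroup E] [MeasurableSpace E] (μ : Measure E)
    (K : E → ℝ) (u : E → ℝ) (x : E) : ℝ :=
  (1 / 2) * ∫ z, (u (x + z) + u (x - z) - 2 * u x) * K z ∂μ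

/-- (K1): the kernel is symmetric. -/
def KernelSymm {E : Type*} [MeasurableSpace E] [Neg E] (μ : Measure E) (K : E → ℝ) : Prop :=
  ∀ᵐ z ∂μ, K (-z) = K z

/-- (K2): `λ χ_{B_{r0}}(z) |z|^{-N-2s} ≤ K(z) ≤ Λ |z|^{-N-2s}` for a.e. `z`. -/
def KernelK2 {E : Type*} [NormedAddCommGroup E] [MeasurableSpace E] (μ : Measure E)
    (K : E → ℝ) (N : ℕ) (s lam Lam r0 : ℝ) : Prop :=
  ∀ᵐ z ∂μ, K z ≤ Lam * ‖z‖ ^ (-(N : ℝ) - 2 * s) ∧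
    (‖z‖ < r0 → lam * ‖z‖ ^ (-(N : ℝ) - 2 * s) ≤ K z)

/-- (K2'): `λ |z|^{-N-2s} ≤ K(z) ≤ Λ |z|^{-N-2s}` for a.e. `z`. -/
def KernelK2' {E : Type*} [NormedAddCommGroup E] [MeasurableSpace E] (μ : Measure E)
    (K : E → ℝ) (N : ℕ) (s lam Lam : ℝ) : Prop :=
  ∀ᵐ z ∂μ, lam * ‖z‖ ^ (-(N : ℝ) - 2 * s) ≤ K z ∧ K z ≤ Lam * ‖z‖ ^ (-(N : ℝ) - 2 * s)

/-- `W` is of class `C^{2,β}_loc(ℝ)`. -/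
def IsC2HolderLoc (β : ℝ) (W : ℝ → ℝ) : Prop :=
  ContDiff ℝ 2 W ∧ ∀ R : ℝ, 0 < R → ∃ C : NNReal,
    HolderOnWith C β.toNNReal (deriv (deriv W)) (Icc (-R) R)

/-- `f` is of (global) class `C^γ`: it is `C^{⌊γ⌋}` and the `⌊γ⌋`-th derivative is
globally Hölder continuous with exponent `γ - ⌊γ⌋`. -/
def IsCHolder {E F : Type*} [NormedAddCommGroup E] [NormedSpace ℝ E]
    [NormedAddCommGroup F] [NormedSpace ℝ F] (γ : ℝ) (f : E → F) : Prop :=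
  ContDiff ℝ (⌊γ⌋₊ : ℕ) f ∧ ∃ C : NNReal,
    HolderWith C (γ - ⌊γ⌋₊).toNNReal (iteratedFDeriv ℝ ⌊γ⌋₊ f)

/-- `f` is of class `C^γ` on the set `Ω`. -/
def IsCHolderOn {E F : Type*} [NormedAddCommGroup E] [NormedSpace ℝ E]
    [NormedAddCommGroup F] [NormedSpace ℝ F] (γ : ℝ) (f : E → F) (Ω : Set E) : Prop :=
  ContDiffOn ℝ (⌊γ⌋₊ : ℕ) f Ω ∧ ∃ C : NNReal,
    HolderOnWith C (γ - ⌊γ⌋₊).toNNReal (iteratedFDerivWithin ℝ ⌊γ⌋₊ f Ω) Ω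

/-- The scaling factor `Ψ_s(R)`. -/
def Psi (s R : ℝ) : ℝ :=
  if s < 1 / 2 then R ^ (1 - 2 * s) else if s = 1 / 2 then Real.log R else 1


section RadialKernel

variable {E : Type*} [NormedAddCommGroup E] [NormedSpace ℝ E] [FiniteDimensional ℝ E]
  [MeasurableSpace E] [BorelSpace E] (μ : Measure E) [μ.IsAddHaarMeasure]

/-- For measurable sets `A`, `B` of finite measure, the interaction of `A` and `B` is at most the
measure of `B` times the total mass of the kernel. -/
theorem integral_integral_japanese_le {α : ℝ} (hα : (Module.finrank ℝ E : ℝ) / 2 < α)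
    {A B : Set E} (hA : μ A ≠ ∞) (hB : μ B ≠ ∞) :
    ∫ x in A, ∫ y in B, (1 + ‖x - y‖ ^ 2) ^ (-α) ∂μ ∂μ
      ≤ (∫ z, (1 + ‖z‖ ^ 2) ^ (-α) ∂μ) * μ.real B := by
  have hα0 : 0 < α := lt_of_le_of_lt (by positivity) hα
  have hint : Integrable (fun z : E => (1 + ‖z‖ ^ 2) ^ (-α)) μ := by
    have := integrable_rpow_neg_one_add_norm_sq (E := E) (μ := μ) (r := 2 * α) (by linarith)
    simpa [neg_mul, neg_div] using this
  have : IsFiniteMeasure (μ.restrict A) := ⟨by simpa using hA.lt_top⟩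
  have : IsFiniteMeasure (μ.restrict B) := ⟨by simpa using hB.lt_top⟩
  have hcont : Continuous (Function.uncurry fun x y : E => (1 + ‖x - y‖ ^ 2) ^ (-α)) := by
    refine Continuous.rpow_const (by fun_prop) fun p => Or.inl ?_
    positivity
  have hprod : Integrable (Function.uncurry fun x y : E => (1 + ‖x - y‖ ^ 2) ^ (-α))
      ((μ.restrict A).prod (μ.restrict B)) := by
    refine Integrable.of_bound hcont.aestronglyMeasurable 1 (Eventually.of_forall fun p => ?_)
    rw [Function.uncurry_def, Real.norm_of_nonneg (by positivity)]
    exact Real.rpow_le_one_of_one_le_of_nonpos (le_add_of_nonneg_right (by positivity))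
      (by linarith)
  rw [integral_integral_swap hprod]
  have hle : ∀ y : E, ∫ x in A, (1 + ‖x - y‖ ^ 2) ^ (-α) ∂μ ≤ ∫ z, (1 + ‖z‖ ^ 2) ^ (-α) ∂μ := by
    intro y
    rw [← integral_sub_right_eq_self (fun z : E => (1 + ‖z‖ ^ 2) ^ (-α)) y]
    exact setIntegral_le_integral (hint.comp_sub_right y)
      (Eventually.of_forall fun x => by positivity)
  calc ∫ y in B, ∫ x in A, (1 + ‖x - y‖ ^ 2) ^ (-α) ∂μ ∂μ
      ≤ ∫ _ in B, (∫ z, (1 + ‖z‖ ^ 2) ^ (-α) ∂μ) ∂μ :=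
        integral_mono_of_nonneg (Eventually.of_forall fun y => by positivity)
          (integrable_const _) (Eventually.of_forall hle)
    _ = _ := by simp [mul_comm]

theorem measureReal_ball_diff_ball {σ ρ : ℝ} (hσ : 0 < σ) (h : σ < ρ) :
    μ.real (Metric.ball 0 ρ \ Metric.ball 0 σ)
      = μ.real (Metric.ball 0 1)
        * (ρ ^ Module.finrank ℝ E - σ ^ Module.finrank ℝ E) := by
  rw [measureReal_sdiff (Metric.ball_subset_ball h.le) measurableSet_ball
    measure_ball_lt_top.ne]
  have hball : ∀ r : ℝ, 0 < r →
      μ.real (Metric.ball 0 r) = r ^ Module.finrank ℝ E * μ.real (Metric.ball 0 1) := by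
    intro r hr
    rw [measureReal_def, Measure.addHaar_ball_of_pos μ 0 hr, ENNReal.toReal_mul,
      ENNReal.toReal_ofReal (by positivity), measureReal_def]
  rw [hball ρ (hσ.trans h), hball σ hσ]
  ring

/-- Tail estimate for the kernel outside a ball `B_ρ` seen from a point `x` of the ball. -/
theorem setIntegral_compl_ball_japanese_le [Nontrivial E] {α p ρ : ℝ} (hpα : p ≤ 2 * α)
    (hpn : (Module.finrank ℝ E : ℝ) < p) {x : E} (hx : x ∈ Metric.ball 0 ρ) :
    ∫ y in (Metric.ball 0 ρ)ᶜ, (1 + ‖x - y‖ ^ 2) ^ (-α) ∂μ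
      ≤ Module.finrank ℝ E * μ.real (Metric.ball 0 1) / (p - Module.finrank ℝ E)
        * (ρ - ‖x‖) ^ (Module.finrank ℝ E - p) := by
  set n := Module.finrank ℝ E with hn
  have hn1 : 1 ≤ n := Module.finrank_pos
  set d := ρ - ‖x‖ with hd
  have hd0 : 0 < d := by simpa [hd] using hx
  set f : ℝ → ℝ := (Ici d).indicator fun r => r ^ (-p) with hf
  have hf0 : ∀ r, 0 ≤ f r := fun r => indicator_nonneg
    (fun r (hr : d ≤ r) => Real.rpow_nonneg (hd0.le.trans hr) _) r
  have hmul : (fun r : ℝ => r ^ (n - 1) • f r) = (Ici d).indicator fun r => r ^ (n - 1 - p) := by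
    ext r
    by_cases hr : r ∈ Ici d
    · have hr0 : 0 < r := hd0.trans_le hr
      simp only [hf, indicator_of_mem hr, smul_eq_mul]
      rw [← Real.rpow_natCast, ← Real.rpow_add hr0, Nat.cast_sub hn1]
      simp [sub_eq_add_neg]
    · simp [hf, indicator_of_notMem hr]
  have hsub : Ici d ∩ Ioi (0 : ℝ) = Ici d := inter_eq_left.2 fun r hr => hd0.trans_le hr
  have hfint : Integrable (fun z : E => f ‖z‖) μ := by
    rw [integrable_fun_norm_addHaar μ, ← hn, hmul]
    rw [IntegrableOn, integrable_indicator_iff measurableSet_Ici, IntegrableOn,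
      Measure.restrict_restrict measurableSet_Ici, hsub, ← IntegrableOn,
      integrableOn_Ici_iff_integrableOn_Ioi]
    exact integrableOn_Ioi_rpow_of_lt (by linarith) hd0
  have hfval : ∫ z, f ‖z‖ ∂μ = n * μ.real (Metric.ball 0 1) / (p - n) * d ^ (n - p) := by
    rw [integral_fun_norm_addHaar μ, ← hn, hmul, setIntegral_indicator measurableSet_Ici,
      inter_comm, hsub, integral_Ici_eq_integral_Ioi, integral_Ioi_rpow_of_lt (by linarith) hd0]
    have h1 : (n : ℝ) - 1 - p + 1 = n - p := by ring
    have h2 : (n : ℝ) - p ≠ 0 := by linarith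
    have h3 : p - (n : ℝ) ≠ 0 := by linarith
    rw [h1, nsmul_eq_mul, smul_eq_mul]
    field_simp
    ring
  rw [← hfval, ← integral_sub_left_eq_self (fun z => f ‖z‖) μ x,
    ← integral_indicator measurableSet_ball.compl]
  refine integral_mono_of_nonneg (Eventually.of_forall fun y => indicator_nonneg
    (fun y _ => by positivity) y) (hfint.comp_sub_left x) (Eventually.of_forall fun y => ?_)
  refine indicator_apply_le' (fun hy => ?_) (fun _ => hf0 _)
  have hy' : ρ ≤ ‖y‖ := by simpa using hy
  have hdy : d ≤ ‖x - y‖ := by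
    have := norm_sub_norm_le y x
    rw [norm_sub_rev] at this
    linarith
  have hr0 : 0 < ‖x - y‖ := hd0.trans_le hdy
  simp only [hf, indicator_of_mem (show ‖x - y‖ ∈ Ici d from hdy)]
  calc (1 + ‖x - y‖ ^ 2) ^ (-α) ≤ (1 + ‖x - y‖ ^ 2) ^ (-(p / 2)) :=
        Real.rpow_le_rpow_of_exponent_le (le_add_of_nonneg_right (by positivity)) (by linarith)
    _ ≤ (‖x - y‖ ^ 2) ^ (-(p / 2)) :=
        Real.rpow_le_rpow_of_nonpos (by positivity) (by linarith) (by linarith)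
    _ = ‖x - y‖ ^ (-p) := by
        rw [← Real.rpow_natCast, ← Real.rpow_mul hr0.le]
        congr 1
        push_cast
        ring

/-- Powers with exponent above `-1` of the distance to the boundary are integrable on balls. -/
theorem integral_ball_rpow_sub_norm_le [Nontrivial E] {β ρ : ℝ} (hβ : -1 < β) (hρ : 0 < ρ) :
    IntegrableOn (fun x : E => (ρ - ‖x‖) ^ β) (Metric.ball 0 ρ) μ ∧
    ∫ x in Metric.ball 0 ρ, (ρ - ‖x‖) ^ β ∂μ
      ≤ Module.finrank ℝ E * μ.real (Metric.ball 0 1) / (β + 1)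
        * ρ ^ (Module.finrank ℝ E + β) := by
  set n := Module.finrank ℝ E with hn
  have hn1 : 1 ≤ n := Module.finrank_pos
  set f : ℝ → ℝ := (Iio ρ).indicator fun r => (ρ - r) ^ β with hf
  have hind : (Metric.ball (0 : E) ρ).indicator (fun x => (ρ - ‖x‖) ^ β) = fun x => f ‖x‖ := by
    ext x
    by_cases hx : ‖x‖ < ρ <;> simp [hf, hx]
  have hmul : (fun r : ℝ => r ^ (n - 1) • f r)
      = (Iio ρ).indicator fun r => r ^ (n - 1) * (ρ - r) ^ β := by
    ext r
    by_cases hr : r ∈ Iio ρ <;> simp [hf, hr]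
  have hset : Iio ρ ∩ Ioi 0 = Ioo 0 ρ := by rw [inter_comm]; rfl
  have hpow : IntervalIntegrable (fun r : ℝ => (ρ - r) ^ β) volume 0 ρ := by
    have := (intervalIntegral.intervalIntegrable_rpow' (a := 0) (b := ρ) hβ).comp_sub_left ρ
    simpa using this.symm
  have hpow' : IntegrableOn (fun r : ℝ => (ρ - r) ^ β) (Ioo 0 ρ) :=
    (intervalIntegrable_iff_integrableOn_Ioo_of_le hρ.le).1 hpow
  have hprod : IntegrableOn (fun r : ℝ => r ^ (n - 1) * (ρ - r) ^ β) (Ioo 0 ρ) := by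
    refine Integrable.bdd_mul (c := ρ ^ (n - 1)) hpow'
      (by fun_prop : Continuous fun r : ℝ => r ^ (n - 1)).aestronglyMeasurable ?_
    filter_upwards [ae_restrict_mem measurableSet_Ioo] with r hr
    rw [norm_pow, Real.norm_of_nonneg hr.1.le]
    exact pow_le_pow_left₀ hr.1.le hr.2.le _
  have hfint : Integrable (fun x : E => f ‖x‖) μ := by
    rw [integrable_fun_norm_addHaar μ, ← hn, hmul, IntegrableOn,
      integrable_indicator_iff measurableSet_Iio, IntegrableOn,
      Measure.restrict_restrict measurableSet_Iio, hset]
    exact hprod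
  refine ⟨?_, ?_⟩
  · rw [← integrable_indicator_iff measurableSet_ball, hind]
    exact hfint
  have hbound : ∫ r in Ioo 0 ρ, r ^ (n - 1) * (ρ - r) ^ β ≤ ρ ^ (n + β) / (β + 1) := by
    calc ∫ r in Ioo 0 ρ, r ^ (n - 1) * (ρ - r) ^ β
        ≤ ∫ r in Ioo 0 ρ, ρ ^ (n - 1) * (ρ - r) ^ β := by
          refine setIntegral_mono_on hprod (hpow'.const_mul _) measurableSet_Ioo fun r hr => ?_
          have := Real.rpow_nonneg (sub_nonneg.2 hr.2.le) β
          gcongr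
          · exact hr.1.le
          · exact hr.2.le
      _ = ρ ^ (n - 1) * ∫ r in (0)..ρ, (ρ - r) ^ β := by
          rw [integral_const_mul, intervalIntegral.integral_of_le hρ.le,
            integral_Ioc_eq_integral_Ioo]
      _ = ρ ^ (n + β) / (β + 1) := by
          rw [intervalIntegral.integral_comp_sub_left (fun r => r ^ β) ρ, sub_self, sub_zero,
            integral_rpow (Or.inl hβ), Real.zero_rpow (by linarith), sub_zero, ← mul_div_assoc,
            ← Real.rpow_natCast, ← Real.rpow_add hρ, Nat.cast_sub hn1]
          congr 2
          push_cast
          ring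
  rw [← integral_indicator measurableSet_ball, hind, integral_fun_norm_addHaar μ, ← hn, hmul,
    setIntegral_indicator measurableSet_Iio, inter_comm, hset, nsmul_eq_mul, smul_eq_mul]
  calc (n : ℝ) * (μ.real (Metric.ball 0 1) * ∫ r in Ioo 0 ρ, r ^ (n - 1) * (ρ - r) ^ β)
      ≤ n * (μ.real (Metric.ball 0 1) * (ρ ^ (n + β) / (β + 1))) := by gcongr
    _ = _ := by ring

end RadialKernel

/-- Lemma 4.8: integral estimates for `(1+|x-y|²)^{-α}`. The constant `C1` depends only on `N`
and `α`; the constant `C2` may also depend on `δ`. -/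
theorem integral_estimates
    (N : ℕ) (hN : 1 ≤ N) (α : ℝ) (hα : (N : ℝ) / 2 < α) :
    (∃ C1 : ℝ, 0 < C1 ∧ ∀ ρ σ : ℝ, 0 < σ → σ < ρ →
      (∫ x in Metric.ball (0 : EuclideanSpace ℝ (Fin N)) ρ,
          ∫ y in Metric.ball (0 : EuclideanSpace ℝ (Fin N)) ρ \ Metric.ball 0 σ,
            ((1 : ℝ) + ‖x - y‖ ^ 2) ^ (-α))
        ≤ C1 * (ρ ^ N - σ ^ N)) ∧
    (∀ δ : ℝ, 0 < δ → δ < 1 → (N : ℝ) / (2 * α) < δ → δ < ((N : ℝ) + 1) / (2 * α) →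
      ∃ C2 : ℝ, 0 < C2 ∧ ∀ ρ σ : ℝ, 0 < σ → σ < ρ →
        (∫ x in Metric.ball (0 : EuclideanSpace ℝ (Fin N)) ρ,
            ∫ y in (Metric.ball (0 : EuclideanSpace ℝ (Fin N)) ρ)ᶜ,
              ((1 : ℝ) + ‖x - y‖ ^ 2) ^ (-α))
          ≤ C2 * ρ ^ (2 * (N : ℝ) - 2 * δ * α)) := by
  have : NeZero N := ⟨by omega⟩
  have hfr : Module.finrank ℝ (EuclideanSpace ℝ (Fin N)) = N := finrank_euclideanSpace_fin
  have hNpos : (0 : ℝ) < N := by exact_mod_cast hN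
  have hα0 : 0 < α := lt_trans (by positivity) hα
  set b := volume.real (Metric.ball (0 : EuclideanSpace ℝ (Fin N)) 1)
  have hb : 0 < b := ENNReal.toReal_pos (Metric.measure_ball_pos _ _ one_pos).ne'
    measure_ball_lt_top.ne
  refine ⟨?_, ?_⟩
  · set I := ∫ z : EuclideanSpace ℝ (Fin N), (1 + ‖z‖ ^ 2) ^ (-α)
    have hI : 0 ≤ I := integral_nonneg fun z => by positivity
    refine ⟨(I + 1) * b, by positivity, fun ρ σ hσ h => ?_⟩
    have hpow : σ ^ N ≤ ρ ^ N := pow_le_pow_left₀ hσ.le h.le N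
    refine (integral_integral_japanese_le volume (by rwa [hfr]) measure_ball_lt_top.ne
      (measure_ne_top_of_subset sdiff_subset measure_ball_lt_top.ne)).trans ?_
    rw [measureReal_ball_diff_ball volume hσ h, hfr, ← mul_assoc]
    gcongr
    linarith
  · intro δ hδ0 hδ1 hδN hδN1
    have hlow : (N : ℝ) < 2 * δ * α := by
      rw [div_lt_iff₀ (by positivity)] at hδN
      linarith
    have hupp : 2 * δ * α < N + 1 := by
      rw [lt_div_iff₀ (by positivity)] at hδN1
      linarith
    have hle : 2 * δ * α ≤ 2 * α := by nlinarith
    set p := 2 * δ * α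
    have hpN : 0 < p - N := by linarith
    have hNp : 0 < N - p + 1 := by linarith
    refine ⟨N * b / (p - N) * (N * b / (N - p + 1)), by positivity, fun ρ σ hσ h => ?_⟩
    obtain ⟨hint, hval⟩ := integral_ball_rpow_sub_norm_le
      (volume : Measure (EuclideanSpace ℝ (Fin N))) (β := N - p) (by linarith) (hσ.trans h)
    rw [hfr] at hval
    calc _ ≤ ∫ x in Metric.ball (0 : EuclideanSpace ℝ (Fin N)) ρ,
          N * b / (p - N) * (ρ - ‖x‖) ^ (N - p) := by
          refine setIntegral_mono_of_nonneg (fun x _ => integral_nonneg fun y => by positivity)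
            (fun x hx => ?_) (hint.const_mul _)
          have := setIntegral_compl_ball_japanese_le volume (α := α) (p := p) hle
            (by rwa [hfr]) hx
          rwa [hfr] at this
      _ ≤ N * b / (p - N) * (N * b / (N - p + 1) * ρ ^ (N + (N - p))) := by
          rw [integral_const_mul]
          gcongr
      _ = _ := by
          rw [← mul_assoc]
          congr 2
          ring

end
end

section
/- Let N = 1 and s = 1/2. Assume K satisfies (K1) and (K2') and W satisfies (W1)–(W4), and let u0 be the minimizer of Theorem 1 (odd, strictly increasing, u0 : ℝ → (−1,1), lim_{x→±∞} u0(x) = ±1). Then there exist constants c > 0 and R1 > 0 such that E_K(u0, [−R, R]) ≥ c·log R for every R ≥ R1. -/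
open MeasureTheory Filter Topology Set
open scoped ENNReal NNReal

noncomputable section

/-- Near the diagonal `y = -x` a homogeneous kernel of degree `-2` has logarithmic mass. -/
lemma lintegral_regionBetween_const_div_sq {lam M R : ℝ} (hlam : 0 < lam) (hM : 0 < M)
    (hR : M ≤ R) :
    ∫⁻ p in regionBetween (fun x : ℝ => -2 * x) (fun x => -x) (Icc M R),
        ENNReal.ofReal (lam / (9 * p.1 ^ 2)) ∂((volume : Measure ℝ).prod volume) =
      ENNReal.ofReal (lam / 9 * Real.log (R / M)) := by
  have hT : MeasurableSet (regionBetween (fun x : ℝ => -2 * x) (fun x => -x) (Icc M R)) :=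
    measurableSet_regionBetween (by fun_prop) (by fun_prop) measurableSet_Icc
  rw [← lintegral_indicator hT, lintegral_prod _ (by
    refine (Measurable.indicator ?_ hT).aemeasurable
    fun_prop)]
  have hinner : ∀ x : ℝ,
      ∫⁻ y, (regionBetween (fun x : ℝ => -2 * x) (fun x => -x) (Icc M R)).indicator
        (fun p : ℝ × ℝ => ENNReal.ofReal (lam / (9 * p.1 ^ 2))) (x, y) =
      (Icc M R).indicator (fun x => ENNReal.ofReal (lam / 9 * (1 / x))) x := by
    intro x
    by_cases hx : x ∈ Icc M R
    · have hx0 : 0 < x := hM.trans_le hx.1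
      have hsec : (fun y => (regionBetween (fun x : ℝ => -2 * x) (fun x => -x) (Icc M R)).indicator
          (fun p : ℝ × ℝ => ENNReal.ofReal (lam / (9 * p.1 ^ 2))) (x, y)) =
          (Ioo (-2 * x) (-x)).indicator (fun _ => ENNReal.ofReal (lam / (9 * x ^ 2))) := by
        ext y
        simp only [indicator, regionBetween, mem_ofPred_eq, hx, true_and]
      rw [hsec, lintegral_indicator_const measurableSet_Ioo, Real.volume_Ioo,
        indicator_of_mem hx, ← ENNReal.ofReal_mul (by positivity)]
      congr 1
      field_simp
      ring
    · rw [indicator_of_notMem hx]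
      simp [indicator, regionBetween, show ¬ (M ≤ x ∧ x ≤ R) from hx]
  simp_rw [hinner]
  have hcont : ContinuousOn (fun x : ℝ => lam / 9 * (1 / x)) (Icc M R) :=
    continuousOn_const.mul (continuousOn_const.div continuousOn_id
      fun x hx => (hM.trans_le hx.1).ne')
  rw [lintegral_indicator measurableSet_Icc,
    ← ofReal_integral_eq_lintegral_ofReal (hcont.integrableOn_Icc)
      ((ae_restrict_iff' measurableSet_Icc).2 (ae_of_all _ fun x hx => by
        have := hM.trans_le hx.1
        simp only [Pi.zero_apply]
        positivity)),
    integral_Icc_eq_integral_Ioc, ← intervalIntegral.integral_of_le hR,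
    intervalIntegral.integral_const_mul, integral_one_div_of_pos hM (hM.trans_le hR)]

/-- Lemma 5.3: for `s = 1/2` and a kernel satisfying (K1) and (K2'), the energy of the
one-dimensional minimizer `u₀` on `[-R,R]` grows at least like `c log R`. -/
theorem energy_lower_bound_log
    (lam Lam : ℝ) (hlam : 0 < lam) (hlamLam : lam ≤ Lam)
    (K : ℝ → ℝ) (hKmeas : Measurable K)
    (hK1 : KernelSymm volume K) (hK2' : KernelK2' volume K 1 (1 / 2) lam Lam)
    (W : ℝ → ℝ) (hWreg : ∃ β > 0, IsC2HolderLoc β W)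
    (hWnonneg : ∀ r, 0 ≤ W r)
    (hW1 : ∀ r ∈ Ioo (-1 : ℝ) 1, 0 < W r)
    (hW2a : W 1 = 0) (hW2b : W (-1) = 0)
    (hW2c : deriv W 1 = 0) (hW2d : deriv W (-1) = 0)
    (hW3a : 0 < deriv (deriv W) 1) (hW3b : 0 < deriv (deriv W) (-1))
    (hW4 : ∀ r ∈ Icc (-1 : ℝ) 1, W (-r) = W r)
    -- `u₀` is the minimizer given by Theorem 1:
    (u0 : ℝ → ℝ)
    (hu0range : ∀ x, u0 x ∈ Ioo (-1 : ℝ) 1)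
    (hu0odd : ∀ x, u0 (-x) = -u0 x)
    (hu0mono : StrictMono u0)
    (hu0zero : u0 0 = 0)
    (hu0top : Tendsto u0 atTop (𝓝 1)) (hu0bot : Tendsto u0 atBot (𝓝 (-1)))
    (hu0min : IsClassAMinimizer volume K W u0) :
    ∃ c : ℝ, 0 < c ∧ ∃ R1 : ℝ, 0 < R1 ∧ ∀ R : ℝ, R1 ≤ R →
      ENNReal.ofReal (c * Real.log R) ≤ nlEnergy volume K W u0 (Icc (-R) R) := by
  obtain ⟨A, hA⟩ : ∃ A : ℝ, ∀ x, A ≤ x → 1 / 2 ≤ u0 x :=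
    eventually_atTop.1 (hu0top.eventually (eventually_ge_nhds (show (1 / 2 : ℝ) < 1 by norm_num)))
  set M := max A 1
  have hM1 : 1 ≤ M := le_max_right _ _
  have hu : ∀ x, M ≤ x → 1 / 2 ≤ u0 x := fun x hx => hA x ((le_max_left _ _).trans hx)
  refine ⟨lam / 72, by positivity, M ^ 2, by positivity, fun R hR => ?_⟩
  have hMR : M ≤ R := by nlinarith
  have hlog : Real.log R ≤ 2 * Real.log (R / M) := by
    have h := Real.log_le_log (by positivity) hR
    rw [Real.log_pow] at h
    rw [Real.log_div (by linarith) (by linarith)]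
    push_cast at h
    linarith
  set T := regionBetween (fun x : ℝ => -2 * x) (fun x => -x) (Icc M R)
  have hT : MeasurableSet T :=
    measurableSet_regionBetween (by fun_prop) (by fun_prop) measurableSet_Icc
  have hTsub : T ⊆ ((Icc (-R) R)ᶜ ×ˢ (Icc (-R) R)ᶜ)ᶜ := fun p hp hq =>
    hq.1 ⟨by linarith [hp.1.1], hp.1.2⟩
  have hK : ∀ᵐ p ∂((volume : Measure ℝ).prod volume),
      lam * ‖p.1 - p.2‖ ^ (-((1 : ℕ) : ℝ) - 2 * (1 / 2)) ≤ K (p.1 - p.2) :=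
    (quasiMeasurePreserving_sub volume volume).ae (hK2'.mono fun _ h => h.1)
  have hpt : ∫⁻ p in T, ENNReal.ofReal (lam / (9 * p.1 ^ 2)) ∂((volume : Measure ℝ).prod volume) ≤
      ∫⁻ p in T, ENNReal.ofReal ((u0 p.1 - u0 p.2) ^ 2 * K (p.1 - p.2))
        ∂((volume : Measure ℝ).prod volume) := by
    refine setLIntegral_mono_ae' hT (hK.mono fun p hp hpT => ENNReal.ofReal_le_ofReal ?_)
    obtain ⟨⟨hx1, -⟩, hy1, hy2⟩ := hpT
    have hd : 0 < p.1 - p.2 := by linarith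
    have hexp : -((1 : ℕ) : ℝ) - 2 * (1 / 2) = -((2 : ℕ) : ℝ) := by norm_num
    rw [hexp, Real.norm_of_nonneg hd.le, Real.rpow_neg hd.le, Real.rpow_natCast,
      ← div_eq_mul_inv] at hp
    have hsq : (p.1 - p.2) ^ 2 ≤ 9 * p.1 ^ 2 := by nlinarith
    have hK0 : lam / (9 * p.1 ^ 2) ≤ K (p.1 - p.2) :=
      (div_le_div_of_nonneg_left hlam.le (by positivity) hsq).trans hp
    have hpos : 0 ≤ lam / (9 * p.1 ^ 2) := by positivity
    have h1 := hu p.1 hx1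
    have h2 := hu (-p.2) (by linarith)
    rw [hu0odd] at h2
    have h3 : 1 ≤ (u0 p.1 - u0 p.2) ^ 2 := by nlinarith
    nlinarith
  rw [lintegral_regionBetween_const_div_sq hlam (by linarith) hMR] at hpt
  have hbound := hpt.trans (lintegral_mono_set hTsub)
  calc ENNReal.ofReal (lam / 72 * Real.log R)
      ≤ ENNReal.ofReal (1 / 4 * (lam / 9 * Real.log (R / M))) :=
        ENNReal.ofReal_le_ofReal (by nlinarith)
    _ = 1 / 4 * ENNReal.ofReal (lam / 9 * Real.log (R / M)) := by
        rw [ENNReal.ofReal_mul (by norm_num), ENNReal.ofReal_div_of_pos (by norm_num)]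
        norm_num
    _ ≤ nlEnergy volume K W u0 (Icc (-R) R) :=
        (mul_le_mul_right hbound _).trans le_self_add

end
end
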